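/- Let t ∈ ℝ and let C be a bounded operator on 𝓗² that commutes with Λ_t. If C = Π_t^- C Π_t^+, then, setting B = (1/2)Λ_t^{-1}C, one has C = B V(t) − V(t) B. If instead C = Π_t^+ C Π_t^-, then, with the same B, one has C = V(t) B − B V(t). -/

import Mathlib

open ContinuousLinearMap Complex Filter Topology
open scoped InnerProductSpace

noncomputable section

variable {H : Type*} [NormedAddCommGroup H] [InnerProductSpace ℂ H] [CompleteSpace H]

/-- Functional calculus `χ(A)` of a selfadjoint operator `A` for a complex-valued
function `χ : ℝ → ℂ` (defined via the real continuous functional calculus applied to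
the real and imaginary parts of `χ`). -/
def fc (χ : ℝ → ℂ) (A : H →L[ℂ] H) : H →L[ℂ] H :=
  cfc (fun x : ℝ => (χ x).re) A + Complex.I • cfc (fun x : ℝ => (χ x).im) A

/-- The commutation assumption: for every continuous `χ : ℝ → ℂ`,
`χ(GG*)G = Gχ(G*G)` and `χ(G*G)G* = G*χ(GG*)`. -/
def CommHyp (G : H →L[ℂ] H) : Prop :=
  ∀ χ : ℝ → ℂ, Continuous χ →
    (fc χ (G * ContinuousLinearMap.adjoint G)) ∘L G
        = G ∘L (fc χ (ContinuousLinearMap.adjoint G * G)) ∧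
    (fc χ (ContinuousLinearMap.adjoint G * G)) ∘L ContinuousLinearMap.adjoint G
        = ContinuousLinearMap.adjoint G ∘L (fc χ (G * ContinuousLinearMap.adjoint G))

/-- The equivalence between `𝓗²` (with its Hilbert space structure) and `𝓗 × 𝓗`. -/
def eqv : WithLp 2 (H × H) ≃L[ℂ] H × H := WithLp.prodContinuousLinearEquiv 2 ℂ H H

/-- The operator `V(s)(w₁,w₂) = (s·w₁ + Gw₂, G*w₁ − s·w₂)` on `𝓗²`. -/
def Vop (G : H →L[ℂ] H) (s : ℝ) : WithLp 2 (H × H) →L[ℂ] WithLp 2 (H × H) :=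
  (eqv (H := H)).symm.toContinuousLinearMap ∘L
    ((((s : ℂ) • ContinuousLinearMap.fst ℂ H H + G ∘L ContinuousLinearMap.snd ℂ H H)).prod
      ((ContinuousLinearMap.adjoint G) ∘L ContinuousLinearMap.fst ℂ H H
        - (s : ℂ) • ContinuousLinearMap.snd ℂ H H)) ∘L
    (eqv (H := H)).toContinuousLinearMap

/-- `F₁(u) = f₁(‖u₁‖², ‖u₂‖²)`. -/
def F1 (f₁ : ℝ × ℝ → ℝ) (u : WithLp 2 (H × H)) : ℝ := f₁ (‖u.fst‖ ^ 2, ‖u.snd‖ ^ 2)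

/-- `F₂(u) = f₂(‖u₁‖², ‖u₂‖²)`. -/
def F2 (f₂ : ℝ × ℝ → ℝ) (u : WithLp 2 (H × H)) : ℝ := f₂ (‖u.fst‖ ^ 2, ‖u.snd‖ ^ 2)

/-- The nonlinear term `F(u)u = (F₁(u)u₁, F₂(u)u₂)`. -/
def nlt (f₁ f₂ : ℝ × ℝ → ℝ) (u : WithLp 2 (H × H)) : WithLp 2 (H × H) :=
  (WithLp.equiv 2 (H × H)).symm ((F1 f₁ u) • u.fst, (F2 f₂ u) • u.snd)

/-- `u` is a (global, `C¹`) solution of `−i u′(s) = V(s)u(s) + δ F(u(s))u(s)`: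
equivalently, `u′(s) = i (V(s)u(s) + δ F(u(s))u(s))` for all `s`. -/
def IsLZSol (G : H →L[ℂ] H) (δ : ℝ) (f₁ f₂ : ℝ × ℝ → ℝ) (u : ℝ → WithLp 2 (H × H)) : Prop :=
  ∀ s : ℝ, HasDerivAt u (Complex.I • (Vop G s (u s) + δ • nlt f₁ f₂ (u s))) s

/-- `f ∈ C²(ℝ²;ℝ)` with bounded second derivative. -/
def C2Bdd (f : ℝ × ℝ → ℝ) : Prop :=
  ContDiff ℝ 2 f ∧ ∃ C : ℝ, ∀ p : ℝ × ℝ, ‖iteratedFDeriv ℝ 2 f p‖ ≤ C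

/-- `θ ∈ C_c^∞(ℝ;ℝ)`, `0 ≤ θ ≤ 1`, `θ = 1` on `(−1/2,1/2)` and `θ = 0` outside `[−1,1]`. -/
def IsCutoff (θ : ℝ → ℝ) : Prop :=
  ContDiff ℝ (⊤ : ℕ∞) θ ∧ HasCompactSupport θ ∧ (∀ x, 0 ≤ θ x ∧ θ x ≤ 1) ∧
    (∀ x, |x| < 1/2 → θ x = 1) ∧ (∀ x, 1 < |x| → θ x = 0)

/-- The cutoff operator `Θ_R = diag(θ(GG*/R²), θ(G*G/R²))`. -/
def Theta (G : H →L[ℂ] H) (θ : ℝ → ℝ) (R : ℝ) :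
    WithLp 2 (H × H) →L[ℂ] WithLp 2 (H × H) :=
  (eqv (H := H)).symm.toContinuousLinearMap ∘L
    ((cfc (fun x : ℝ => θ (x / R ^ 2)) (G * ContinuousLinearMap.adjoint G)).prodMap
      (cfc (fun x : ℝ => θ (x / R ^ 2)) (ContinuousLinearMap.adjoint G * G))) ∘L
    (eqv (H := H)).toContinuousLinearMap

/-- The phase `φ(s,λ) = s²/2 + (λ/2)·log|s|`. -/
def phase (s lam : ℝ) : ℝ := s ^ 2 / 2 + lam / 2 * Real.log |s|

/-- The unitary operator `e^{iφ(s,GG*)}` on `𝓗`. -/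
def ePhaseP (G : H →L[ℂ] H) (s : ℝ) : H →L[ℂ] H :=
  fc (fun lam => Complex.exp (Complex.I * (phase s lam))) (G * ContinuousLinearMap.adjoint G)

/-- The unitary operator `e^{−iφ(s,G*G)}` on `𝓗`. -/
def ePhaseM (G : H →L[ℂ] H) (s : ℝ) : H →L[ℂ] H :=
  fc (fun lam => Complex.exp (-(Complex.I * (phase s lam))))
    (ContinuousLinearMap.adjoint G * G)

/-- The model asymptotic first component `e^{iδF₁(ω)s + iϕ}·e^{iφ(s,GG*)}ω₁`. -/
def asym1 (G : H →L[ℂ] H) (δ : ℝ) (f₁ : ℝ × ℝ → ℝ) (ω : WithLp 2 (H × H)) (ϕ : ℝ)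
    (s : ℝ) : H :=
  Complex.exp (Complex.I * (δ * F1 f₁ ω * s + ϕ)) • (ePhaseP G s ω.fst)

/-- The model asymptotic second component `e^{iδF₂(ω)s − iϕ}·e^{−iφ(s,G*G)}ω₂`. -/
def asym2 (G : H →L[ℂ] H) (δ : ℝ) (f₂ : ℝ × ℝ → ℝ) (ω : WithLp 2 (H × H)) (ϕ : ℝ)
    (s : ℝ) : H :=
  Complex.exp (Complex.I * (δ * F2 f₂ ω * s - ϕ)) • (ePhaseM G s ω.snd)

/-- `α` is the incoming scattering state (at `s → −∞`) of `u`, with phase shift `ϕ`. -/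
def Incoming (G : H →L[ℂ] H) (δ : ℝ) (f₁ f₂ : ℝ × ℝ → ℝ) (α : WithLp 2 (H × H)) (ϕ : ℝ)
    (u : ℝ → WithLp 2 (H × H)) : Prop :=
  Tendsto (fun s => ‖(u s).fst - asym1 G δ f₁ α ϕ s‖ + ‖(u s).snd - asym2 G δ f₂ α ϕ s‖)
    atBot (𝓝 0)

/-- `ω` is the outgoing scattering state (at `s → +∞`) of `u`, with phase shift `ϕ`. -/
def Outgoing (G : H →L[ℂ] H) (δ : ℝ) (f₁ f₂ : ℝ × ℝ → ℝ) (ω : WithLp 2 (H × H)) (ϕ : ℝ)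
    (u : ℝ → WithLp 2 (H × H)) : Prop :=
  Tendsto (fun s => ‖(u s).fst - asym1 G δ f₁ ω ϕ s‖ + ‖(u s).snd - asym2 G δ f₂ ω ϕ s‖)
    atTop (𝓝 0)

/-- `M(u) = (δ/2)(F₁(u) + F₂(u))`. -/
def Mscal (δ : ℝ) (f₁ f₂ : ℝ × ℝ → ℝ) (u : WithLp 2 (H × H)) : ℝ :=
  δ / 2 * (F1 f₁ u + F2 f₂ u)

/-- `m(u) = (δ/2)(F₁(u) − F₂(u))`. -/
def mscal (δ : ℝ) (f₁ f₂ : ℝ × ℝ → ℝ) (u : WithLp 2 (H × H)) : ℝ :=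
  δ / 2 * (F1 f₁ u - F2 f₂ u)

/-- The gauge transform `v(s) = e^{−i∫₀ˢ M(u(τ))dτ}·u(s)`. -/
def gaugeT (δ : ℝ) (f₁ f₂ : ℝ × ℝ → ℝ) (u : ℝ → WithLp 2 (H × H)) :
    ℝ → WithLp 2 (H × H) :=
  fun s => Complex.exp (-(Complex.I * (∫ τ in (0:ℝ)..s, Mscal δ f₁ f₂ (u τ)))) • u s

/-- `σ(s) = s + m(u(s))`. -/
def sigma (δ : ℝ) (f₁ f₂ : ℝ × ℝ → ℝ) (u : ℝ → WithLp 2 (H × H)) (s : ℝ) : ℝ :=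
  s + mscal δ f₁ f₂ (u s)

/-- The operator `Λ_t = diag((t² + GG*)^{1/2}, (t² + G*G)^{1/2})` on `𝓗²`. -/
def LamOp (G : H →L[ℂ] H) (t : ℝ) : WithLp 2 (H × H) →L[ℂ] WithLp 2 (H × H) :=
  (eqv (H := H)).symm.toContinuousLinearMap ∘L
    ((cfc (fun x : ℝ => Real.sqrt (t ^ 2 + x)) (G * ContinuousLinearMap.adjoint G)).prodMap
      (cfc (fun x : ℝ => Real.sqrt (t ^ 2 + x)) (ContinuousLinearMap.adjoint G * G))) ∘L
    (eqv (H := H)).toContinuousLinearMap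

/-- The operator `Λ_t⁻¹ = diag((t² + GG*)^{-1/2}, (t² + G*G)^{-1/2})` on `𝓗²`. -/
def LamInv (G : H →L[ℂ] H) (t : ℝ) : WithLp 2 (H × H) →L[ℂ] WithLp 2 (H × H) :=
  (eqv (H := H)).symm.toContinuousLinearMap ∘L
    ((cfc (fun x : ℝ => (Real.sqrt (t ^ 2 + x))⁻¹)
        (G * ContinuousLinearMap.adjoint G)).prodMap
      (cfc (fun x : ℝ => (Real.sqrt (t ^ 2 + x))⁻¹)
        (ContinuousLinearMap.adjoint G * G))) ∘L
    (eqv (H := H)).toContinuousLinearMap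

/-- The projection `Π_t^+ = (1/2)(Id + Λ_t⁻¹V(t))`. -/
def PiP (G : H →L[ℂ] H) (t : ℝ) : WithLp 2 (H × H) →L[ℂ] WithLp 2 (H × H) :=
  (2 : ℂ)⁻¹ • (1 + LamInv G t ∘L Vop G t)

/-- The projection `Π_t^- = (1/2)(Id − Λ_t⁻¹V(t))`. -/
def PiM (G : H →L[ℂ] H) (t : ℝ) : WithLp 2 (H × H) →L[ℂ] WithLp 2 (H × H) :=
  (2 : ℂ)⁻¹ • (1 - LamInv G t ∘L Vop G t)

/-- `m̃(x,y) = (δ/2)(f₁(x,y) − f₂(x,y))`. -/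
def mtilde (δ : ℝ) (f₁ f₂ : ℝ × ℝ → ℝ) : ℝ × ℝ → ℝ := fun p => δ / 2 * (f₁ p - f₂ p)

/-- `m̲(s) = (∂₁m̃ − ∂₂m̃)(‖v₁(s)‖², ‖v₂(s)‖²)`. -/
def mbar (δ : ℝ) (f₁ f₂ : ℝ × ℝ → ℝ) (v : ℝ → WithLp 2 (H × H)) (s : ℝ) : ℝ :=
  fderiv ℝ (mtilde δ f₁ f₂) (‖(v s).fst‖ ^ 2, ‖(v s).snd‖ ^ 2) (1, 0) -
    fderiv ℝ (mtilde δ f₁ f₂) (‖(v s).fst‖ ^ 2, ‖(v s).snd‖ ^ 2) (0, 1)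


/-- The operator `A(a,b,c,d)(w₁,w₂) = (a(GG*)w₁ + b(GG*)Gw₂, c(G*G)G*w₁ + d(G*G)w₂)`. -/
def Aop (G : H →L[ℂ] H) (a b c d : ℝ → ℂ) :
    WithLp 2 (H × H) →L[ℂ] WithLp 2 (H × H) :=
  (eqv (H := H)).symm.toContinuousLinearMap ∘L
    (((fc a (G * ContinuousLinearMap.adjoint G)) ∘L ContinuousLinearMap.fst ℂ H H
        + (fc b (G * ContinuousLinearMap.adjoint G)) ∘L G ∘L ContinuousLinearMap.snd ℂ H H).prod
      ((fc c (ContinuousLinearMap.adjoint G * G)) ∘L (ContinuousLinearMap.adjoint G)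
          ∘L ContinuousLinearMap.fst ℂ H H
        + (fc d (ContinuousLinearMap.adjoint G * G)) ∘L ContinuousLinearMap.snd ℂ H H)) ∘L
    (eqv (H := H)).toContinuousLinearMap

/-- The operator `𝒦(w₁,w₂) = (−Gw₂, G*w₁)` on `𝓗²`. -/
def Kcal (G : H →L[ℂ] H) : WithLp 2 (H × H) →L[ℂ] WithLp 2 (H × H) :=
  (eqv (H := H)).symm.toContinuousLinearMap ∘L
    ((-(G ∘L ContinuousLinearMap.snd ℂ H H)).prod
      ((ContinuousLinearMap.adjoint G) ∘L ContinuousLinearMap.fst ℂ H H)) ∘L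
    (eqv (H := H)).toContinuousLinearMap


theorem eq_commutator_of_sandwich {R : Type*} [Ring R] [Algebra ℂ R] {L K V C : R}
    (hLK : L * K = 1) (hKL : K * L = 1) (hLV : L * V = V * L) (hVV : V * V = L * L)
    (hCL : C * L = L * C) :
    (C = ((2 : ℂ)⁻¹ • (1 - K * V)) * (C * ((2 : ℂ)⁻¹ • (1 + K * V))) →
      C = ((2 : ℂ)⁻¹ • (K * C)) * V - V * ((2 : ℂ)⁻¹ • (K * C))) ∧
    (C = ((2 : ℂ)⁻¹ • (1 + K * V)) * (C * ((2 : ℂ)⁻¹ • (1 - K * V))) →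
      C = V * ((2 : ℂ)⁻¹ • (K * C)) - ((2 : ℂ)⁻¹ • (K * C)) * V) := by
  have inv_comm : ∀ X : R, X * L = L * X → X * K = K * X := fun X hX =>
    calc X * K = K * (L * X) * K := by rw [← mul_assoc K L X, hKL, one_mul]
      _ = K * X * (L * K) := by rw [← hX]; simp only [mul_assoc]
      _ = K * X := by rw [hLK, mul_one]
  have hKV : V * K = K * V := inv_comm V hLV.symm
  have hKC : C * K = K * C := inv_comm C hCL
  have hJJ : K * V * (K * V) = 1 :=
    calc K * V * (K * V) = K * (V * K) * V := by simp only [mul_assoc]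
      _ = K * K * (V * V) := by rw [hKV]; simp only [mul_assoc]
      _ = K * (K * L) * L := by rw [hVV]; simp only [mul_assoc]
      _ = 1 := by rw [hKL, mul_one, hKL]
  set J : R := K * V
  have e₁ : K * C * V = C * J := by rw [← hKC, mul_assoc]
  have e₂ : V * (K * C) = J * C := by rw [← mul_assoc, hKV]
  have absorb : ∀ X : R, (2 : ℂ)⁻¹ • (X + X) = X := fun X => by
    rw [← two_smul ℂ X, smul_smul]; norm_num
  have hp : (1 + J) * J = 1 + J := by rw [add_mul, one_mul, hJJ, add_comm]
  have hm : (1 - J) * J = -(1 - J) := by rw [sub_mul, one_mul, hJJ, neg_sub]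
  have hp' : J * (1 + J) = 1 + J := by rw [mul_add, mul_one, hJJ, add_comm]
  have hm' : J * (1 - J) = -(1 - J) := by rw [mul_sub, mul_one, hJJ, neg_sub]
  simp only [smul_mul_assoc, mul_smul_comm, e₁, e₂]
  constructor
  · intro h
    have hr : C * J = C := by
      conv_lhs => rw [h]
      conv_rhs => rw [h]
      simp only [smul_mul_assoc, mul_assoc, hp]
    have hl : J * C = -C := by
      conv_lhs => rw [h]
      conv_rhs => rw [h]
      simp only [mul_smul_comm, ← mul_assoc, hm', neg_mul, smul_neg]
    rw [hr, hl, ← smul_sub, sub_neg_eq_add, absorb]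
  · intro h
    have hr : C * J = -C := by
      conv_lhs => rw [h]
      conv_rhs => rw [h]
      simp only [smul_mul_assoc, mul_assoc, hm, mul_neg, smul_neg]
    have hl : J * C = C := by
      conv_lhs => rw [h]
      conv_rhs => rw [h]
      simp only [mul_smul_comm, ← mul_assoc, hp']
    rw [hr, hl, ← smul_sub, sub_neg_eq_add, absorb]

theorem cfc_sqrt_mul_self {A : H →L[ℂ] H} (hA : 0 ≤ A) (t : ℝ) :
    cfc (fun x : ℝ => Real.sqrt (t ^ 2 + x)) A * cfc (fun x : ℝ => Real.sqrt (t ^ 2 + x)) A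
      = (t : ℂ) • (t : ℂ) • (1 : H →L[ℂ] H) + A := by
  have hs : IsSelfAdjoint A := IsSelfAdjoint.of_nonneg hA
  rw [← cfc_mul _ _ A, cfc_congr (g := fun x : ℝ => t ^ 2 + x) fun x hx =>
    Real.mul_self_sqrt (add_nonneg (sq_nonneg t) (spectrum_nonneg_of_nonneg hA hx)),
    cfc_const_add (t ^ 2) (fun x : ℝ => x) A, cfc_id' ℝ A, Algebra.algebraMap_eq_smul_one]
  congr 1
  ext x
  simp [pow_two, mul_smul]

theorem cfc_sqrt_mul_cfc_inv {A : H →L[ℂ] H} (hA : 0 ≤ A) (hu : IsUnit A) (t : ℝ) :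
    cfc (fun x : ℝ => Real.sqrt (t ^ 2 + x)) A * cfc (fun x : ℝ => (Real.sqrt (t ^ 2 + x))⁻¹) A
      = 1 := by
  have hs : IsSelfAdjoint A := IsSelfAdjoint.of_nonneg hA
  have hne : ∀ x ∈ spectrum ℝ A, Real.sqrt (t ^ 2 + x) ≠ 0 := fun x hx => by
    have h0 : x ≠ 0 := fun h => spectrum.zero_notMem ℝ hu (h ▸ hx)
    have h1 : 0 ≤ x := spectrum_nonneg_of_nonneg hA hx
    have : 0 < x := lt_of_le_of_ne h1 h0.symm
    positivity
  have hc : ContinuousOn (fun x : ℝ => Real.sqrt (t ^ 2 + x)) (spectrum ℝ A) := by fun_prop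
  rw [← cfc_mul _ (fun x : ℝ => (Real.sqrt (t ^ 2 + x))⁻¹) A hc (hc.inv₀ hne),
    cfc_congr (g := fun _ : ℝ => (1 : ℝ)) fun x hx =>
    mul_inv_cancel₀ (hne x hx), cfc_const_one ℝ A]

theorem cfc_sqrt_inv_mul_cfc {A : H →L[ℂ] H} (hA : 0 ≤ A) (hu : IsUnit A) (t : ℝ) :
    cfc (fun x : ℝ => (Real.sqrt (t ^ 2 + x))⁻¹) A * cfc (fun x : ℝ => Real.sqrt (t ^ 2 + x)) A
      = 1 := by
  rw [cfc_commute_cfc (fun x : ℝ => (Real.sqrt (t ^ 2 + x))⁻¹)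
    (fun x : ℝ => Real.sqrt (t ^ 2 + x)) A |>.eq, cfc_sqrt_mul_cfc_inv hA hu]

theorem mul_adjoint_nonneg (G : H →L[ℂ] H) : 0 ≤ G * ContinuousLinearMap.adjoint G :=
  mul_star_self_nonneg G

theorem adjoint_mul_nonneg (G : H →L[ℂ] H) : 0 ≤ ContinuousLinearMap.adjoint G * G :=
  star_mul_self_nonneg G

theorem isUnit_adjoint {G : H →L[ℂ] H} (hG : IsUnit G) :
    IsUnit (ContinuousLinearMap.adjoint G) :=
  hG.star

theorem fc_ofReal (f : ℝ → ℝ) (A : H →L[ℂ] H) : fc (fun x => (f x : ℂ)) A = cfc f A := by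
  simp [fc]

theorem LamOp_mul_LamInv {G : H →L[ℂ] H} (hG : IsUnit G) (t : ℝ) :
    LamOp G t * LamInv G t = 1 := by
  have h₁ := cfc_sqrt_mul_cfc_inv (mul_adjoint_nonneg G) (hG.mul (isUnit_adjoint hG)) t
  have h₂ := cfc_sqrt_mul_cfc_inv (adjoint_mul_nonneg G) ((isUnit_adjoint hG).mul hG) t
  refine ContinuousLinearMap.ext fun w => (eqv (H := H)).injective (Prod.ext ?_ ?_)
  · simpa [LamOp, LamInv] using DFunLike.congr_fun h₁ (eqv w).1
  · simpa [LamOp, LamInv] using DFunLike.congr_fun h₂ (eqv w).2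

theorem LamInv_mul_LamOp {G : H →L[ℂ] H} (hG : IsUnit G) (t : ℝ) :
    LamInv G t * LamOp G t = 1 := by
  have h₁ := cfc_sqrt_inv_mul_cfc (mul_adjoint_nonneg G) (hG.mul (isUnit_adjoint hG)) t
  have h₂ := cfc_sqrt_inv_mul_cfc (adjoint_mul_nonneg G) ((isUnit_adjoint hG).mul hG) t
  refine ContinuousLinearMap.ext fun w => (eqv (H := H)).injective (Prod.ext ?_ ?_)
  · simpa [LamOp, LamInv] using DFunLike.congr_fun h₁ (eqv w).1
  · simpa [LamOp, LamInv] using DFunLike.congr_fun h₂ (eqv w).2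

theorem LamOp_mul_Vop {G : H →L[ℂ] H} (hG : CommHyp G) (t : ℝ) :
    LamOp G t * Vop G t = Vop G t * LamOp G t := by
  obtain ⟨h₁, h₂⟩ := hG (fun x => (Real.sqrt (t ^ 2 + x) : ℂ)) (by fun_prop)
  rw [fc_ofReal, fc_ofReal] at h₁ h₂
  refine ContinuousLinearMap.ext fun w => (eqv (H := H)).injective (Prod.ext ?_ ?_)
  · simpa [LamOp, Vop] using DFunLike.congr_fun h₁ (eqv w).2
  · simpa [LamOp, Vop] using DFunLike.congr_fun h₂ (eqv w).1

theorem Vop_mul_self (G : H →L[ℂ] H) (t : ℝ) :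
    Vop G t * Vop G t = LamOp G t * LamOp G t := by
  have h₁ := cfc_sqrt_mul_self (mul_adjoint_nonneg G) t
  have h₂ := cfc_sqrt_mul_self (adjoint_mul_nonneg G) t
  refine ContinuousLinearMap.ext fun w => (eqv (H := H)).injective (Prod.ext ?_ ?_)
  · have := DFunLike.congr_fun h₁ (eqv w).1
    simp only [mul_apply_eq_comp, add_apply, smul_apply, one_apply_eq_self,
      Complex.coe_smul] at this
    simp [LamOp, Vop, this]
  · have := DFunLike.congr_fun h₂ (eqv w).2
    simp only [mul_apply_eq_comp, add_apply, smul_apply, one_apply_eq_self,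
      Complex.coe_smul] at this
    simp [LamOp, Vop, this, smul_sub]
    abel

/-- antidiagonal operators are commutators with `V(t)`. -/
theorem stmt_11 (G : H →L[ℂ] H) (hG : CommHyp G) (hGu : IsUnit G) (t : ℝ)
    (Cop : WithLp 2 (H × H) →L[ℂ] WithLp 2 (H × H))
    (hcomm : Cop ∘L LamOp G t = LamOp G t ∘L Cop) :
    (Cop = PiM G t ∘L Cop ∘L PiP G t →
      Cop = ((2 : ℂ)⁻¹ • (LamInv G t ∘L Cop)) ∘L Vop G t
          - Vop G t ∘L ((2 : ℂ)⁻¹ • (LamInv G t ∘L Cop))) ∧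
    (Cop = PiP G t ∘L Cop ∘L PiM G t →
      Cop = Vop G t ∘L ((2 : ℂ)⁻¹ • (LamInv G t ∘L Cop))
          - ((2 : ℂ)⁻¹ • (LamInv G t ∘L Cop)) ∘L Vop G t) := by
  exact eq_commutator_of_sandwich (LamOp_mul_LamInv hGu t) (LamInv_mul_LamOp hGu t)
    (LamOp_mul_Vop hG t) (Vop_mul_self G t) hcomm

end
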